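/- Let θ > 0, let z, z′ ∈ ℂ, let n ≥ 1, and suppose t = zz′/θ satisfies (t)_n ≠ 0. Then for every partition λ of n, M^{(n)}_{z,z′,θ}(λ) = M^{(n)}_{−z/θ, −z′/θ, 1/θ}(λ′), where λ′ is the conjugate partition of λ. (Note that the parameter t is the same on both sides, since (−z/θ)(−z′/θ)/(1/θ) = zz′/θ.) -/

import Mathlib

/-- `(z)_{λ,θ} = ∏_{(i,j)∈λ} (z + (j−1) − (i−1)θ)` (1-based `(i,j)`; cells are 0-based). -/
noncomputable def zmPoch (z : ℂ) (μ : YoungDiagram) (θ : ℝ) : ℂ :=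
  ∏ c ∈ μ.cells, (z + (c.2 : ℂ) - (c.1 : ℂ) * (θ : ℂ))

/-- `H(λ,θ) = ∏_{(i,j)∈λ} ((λ_i − j) + (λ′_j − i)θ + 1)`. -/
noncomputable def zmH (μ : YoungDiagram) (θ : ℝ) : ℂ :=
  ∏ c ∈ μ.cells,
    (((μ.rowLen c.1 : ℂ) - (c.2 + 1)) + ((μ.colLen c.2 : ℂ) - (c.1 + 1)) * (θ : ℂ) + 1)

/-- `H′(λ,θ) = ∏_{(i,j)∈λ} ((λ_i − j) + (λ′_j − i)θ + θ)`. -/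
noncomputable def zmH' (μ : YoungDiagram) (θ : ℝ) : ℂ :=
  ∏ c ∈ μ.cells,
    (((μ.rowLen c.1 : ℂ) - (c.2 + 1)) + ((μ.colLen c.2 : ℂ) - (c.1 + 1)) * (θ : ℂ) + (θ : ℂ))

/-- The Pochhammer symbol `(t)_n = t(t+1)⋯(t+n−1)`. -/
noncomputable def pochN (t : ℂ) (n : ℕ) : ℂ := ∏ k ∈ Finset.range n, (t + (k : ℂ))

/-- The `z`-measure with Jack parameter `θ`:
`M^{(n)}_{z,z′,θ}(λ) = n!·(z)_{λ,θ}·(z′)_{λ,θ} / ((t)_n · H(λ,θ) · H′(λ,θ))`, `t = zz′/θ`. -/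
noncomputable def zMeasure (n : ℕ) (z z' : ℂ) (θ : ℝ) (μ : YoungDiagram) : ℂ :=
  (n.factorial : ℂ) * zmPoch z μ θ * zmPoch z' μ θ /
    (pochN (z * z' / (θ : ℂ)) n * zmH μ θ * zmH' μ θ)

theorem YoungDiagram.prod_cells_transpose {M : Type*} [CommMonoid M] (μ : YoungDiagram)
    (f : ℕ × ℕ → M) : ∏ c ∈ μ.transpose.cells, f c = ∏ c ∈ μ.cells, f c.swap :=
  Finset.prod_nbij' Prod.swap Prod.swap (by simp [YoungDiagram.mem_transpose])
    (by simp [YoungDiagram.mem_transpose]) (by simp) (by simp) (by simp)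

theorem zmPoch_transpose (z : ℂ) (μ : YoungDiagram) {θ : ℝ} (hθ : θ ≠ 0) :
    zmPoch (-z / (θ : ℂ)) μ.transpose θ⁻¹ = (-(θ : ℂ)⁻¹) ^ μ.card * zmPoch z μ θ := by
  have hθ' : (θ : ℂ) ≠ 0 := by exact_mod_cast hθ
  rw [zmPoch, zmPoch, YoungDiagram.prod_cells_transpose, YoungDiagram.card,
    ← Finset.prod_const, ← Finset.prod_mul_distrib]
  refine Finset.prod_congr rfl fun c _ => ?_
  simp only [Prod.fst_swap, Prod.snd_swap]
  push_cast
  field_simp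
  ring

theorem zmH_transpose (μ : YoungDiagram) {θ : ℝ} (hθ : θ ≠ 0) :
    zmH μ.transpose θ⁻¹ = (θ : ℂ)⁻¹ ^ μ.card * zmH' μ θ := by
  have hθ' : (θ : ℂ) ≠ 0 := by exact_mod_cast hθ
  rw [zmH, zmH', YoungDiagram.prod_cells_transpose, YoungDiagram.card,
    ← Finset.prod_const, ← Finset.prod_mul_distrib]
  refine Finset.prod_congr rfl fun c _ => ?_
  simp only [Prod.fst_swap, Prod.snd_swap, YoungDiagram.rowLen_transpose,
    YoungDiagram.colLen_transpose]
  push_cast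
  field_simp
  ring

theorem zmH'_transpose (μ : YoungDiagram) {θ : ℝ} (hθ : θ ≠ 0) :
    zmH' μ.transpose θ⁻¹ = (θ : ℂ)⁻¹ ^ μ.card * zmH μ θ := by
  have hθ' : (θ : ℂ) ≠ 0 := by exact_mod_cast hθ
  rw [zmH, zmH', YoungDiagram.prod_cells_transpose, YoungDiagram.card,
    ← Finset.prod_const, ← Finset.prod_mul_distrib]
  refine Finset.prod_congr rfl fun c _ => ?_
  simp only [Prod.fst_swap, Prod.snd_swap, YoungDiagram.rowLen_transpose,
    YoungDiagram.colLen_transpose]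
  push_cast
  field_simp
  ring

/-- For `θ > 0`, `z, z′ ∈ ℂ`, `n ≥ 1` with `(t)_n ≠ 0` where `t = zz′/θ`:
`M^{(n)}_{z,z′,θ}(λ) = M^{(n)}_{−z/θ, −z′/θ, 1/θ}(λ′)` for every partition `λ` of `n`. -/
theorem zMeasure_transpose (n : ℕ) (hn : 1 ≤ n) (z z' : ℂ) (θ : ℝ) (hθ : 0 < θ)
    (ht : pochN (z * z' / (θ : ℂ)) n ≠ 0) (μ : YoungDiagram) (hμ : μ.card = n) :
    zMeasure n z z' θ μ = zMeasure n (-z / (θ : ℂ)) (-z' / (θ : ℂ)) θ⁻¹ μ.transpose := by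
  have hθ' : (θ : ℂ) ≠ 0 := by exact_mod_cast hθ.ne'
  have hpar : -z / (θ : ℂ) * (-z' / (θ : ℂ)) / ((θ⁻¹ : ℝ) : ℂ) = z * z' / (θ : ℂ) := by
    push_cast
    field_simp
  have hc : ((θ : ℂ)⁻¹ ^ μ.card) * ((θ : ℂ)⁻¹ ^ μ.card) ≠ 0 := by positivity
  have hsign : (-(θ : ℂ)⁻¹) ^ μ.card * (-(θ : ℂ)⁻¹) ^ μ.card =
      (θ : ℂ)⁻¹ ^ μ.card * (θ : ℂ)⁻¹ ^ μ.card := by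
    rw [← mul_pow, ← mul_pow, neg_mul_neg]
  rw [zMeasure, zMeasure, hpar, zmPoch_transpose z μ hθ.ne', zmPoch_transpose z' μ hθ.ne',
    zmH_transpose μ hθ.ne', zmH'_transpose μ hθ.ne', ← mul_div_mul_left _ _ hc]
  congr 1
  · linear_combination -(n.factorial : ℂ) * zmPoch z μ θ * zmPoch z' μ θ * hsign
  · ring
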